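/- arXiv:2010.00138 — 3 statements merged into one kernel-verified Lean document; each statement's English description precedes it below -/
import Mathlib

section
/- For every minimization instance I of the DTSPMS on V = {0,1,...,n} with k rows of capacity c ≥ ⌈n/k⌉ in which both d_P and d_D are nonnegative and satisfy the triangle inequality: OPT(I_Σ) ≤ k·OPT(I), where OPT(I) is the minimum value d_P(T_P) + d_D(T_D) over feasible pairs (T_P, T_D) and OPT(I_Σ) is the minimum of d_Σ(T) over all tours T on V, with d_Σ(i,j) = d_P(i,j) + d_D(j,i). -/
open Finset

/-- A tour on `V = {0,1,...,n}` (`0` is the depot) is encoded by a permutation `σ` of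
`Fin n`: the item visited at position `p+1` is `σ p` (items `1,...,n` are encoded as
`Fin n` and embedded in `V = Fin (n+1)` via `Fin.succ`). `tourSeq σ q` is the vertex
visited at position `q` of the cycle (position `0` is the depot). -/
def tourSeq {n : ℕ} (σ : Equiv.Perm (Fin n)) (q : Fin (n + 1)) : Fin (n + 1) :=
  if h : q = 0 then 0 else (σ (q.pred h)).succ

/-- Value of a tour: the sum of `d` over its `n+1` consecutive ordered pairs. -/
def tourValue {n : ℕ} (d : Fin (n + 1) → Fin (n + 1) → ℚ) (σ : Equiv.Perm (Fin n)) : ℚ :=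
  ∑ q : Fin (n + 1), d (tourSeq σ q) (tourSeq σ (q + 1))

/-- The reverse tour `T⁻`. -/
def revTour {n : ℕ} (σ : Equiv.Perm (Fin n)) : Equiv.Perm (Fin n) :=
  Fin.revPerm.trans σ

/-- Tour `σ` visits item `i` before item `j`. -/
def visitsBefore {n : ℕ} (σ : Equiv.Perm (Fin n)) (i j : Fin n) : Prop :=
  σ.symm i < σ.symm j

/-- A loading plan with `k` rows, each of capacity `c`: every fiber has size at most `c`. -/
def IsLoadingPlan {n : ℕ} (k c : ℕ) (f : Fin n → Fin k) : Prop :=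
  ∀ r : Fin k, (Finset.univ.filter fun i => f i = r).card ≤ c

/-- The pair of tours `(σP, σD)` is consistent with the loading plan `f`: items loaded in
the same row are visited in opposite orders by the two tours. -/
def FeasibleFor {n k : ℕ} (f : Fin n → Fin k) (σP σD : Equiv.Perm (Fin n)) : Prop :=
  ∀ i j : Fin n, i ≠ j → f i = f j → (visitsBefore σP i j ↔ visitsBefore σD j i)

/-- `(σP, σD)` is a feasible pair of pickup and delivery tours for parameters `(k, c)`. -/
def FeasiblePair {n : ℕ} (k c : ℕ) (σP σD : Equiv.Perm (Fin n)) : Prop :=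
  ∃ f : Fin n → Fin k, IsLoadingPlan k c f ∧ FeasibleFor f σP σD

/-- `d_Σ(i,j) = d_P(i,j) + d_D(j,i)`. -/
def dSigma {n : ℕ} (dP dD : Fin (n + 1) → Fin (n + 1) → ℚ) (i j : Fin (n + 1)) : ℚ :=
  dP i j + dD j i

/-- The set of values of tours under distance `d`. -/
def tourValues (n : ℕ) (d : Fin (n + 1) → Fin (n + 1) → ℚ) : Set ℚ :=
  {v | ∃ σ : Equiv.Perm (Fin n), v = tourValue d σ}

/-- The set of values of feasible pairs of pickup and delivery tours. -/
def feasibleValues (n k c : ℕ) (dP dD : Fin (n + 1) → Fin (n + 1) → ℚ) : Set ℚ :=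
  {v | ∃ σP σD : Equiv.Perm (Fin n), FeasiblePair k c σP σD ∧
        v = tourValue dP σP + tourValue dD σD}

def walkC {V : Type} (d : V → V → ℚ) : V → List V → V → ℚ
  | a, [], b => d a b
  | a, x :: l, b => d a x + walkC d x l b

theorem walkC_append {V : Type} (d : V → V → ℚ) (a x b : V) (l₁ l₂ : List V) :
    walkC d a (l₁ ++ x :: l₂) b = walkC d a l₁ x + walkC d x l₂ b := by
  induction l₁ generalizing a with
  | nil => simp [walkC]
  | cons y l ih => simp [walkC, ih, add_assoc]

theorem walkC_cons_le {V : Type} (d : V → V → ℚ) (ht : ∀ u v w, d u v ≤ d u w + d w v)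
    (a z b : V) (l : List V) : walkC d a l b ≤ d a z + walkC d z l b := by
  cases l with
  | nil => exact ht _ _ _
  | cons y l => simp only [walkC]; linarith [ht a y z]

theorem walkC_append_le {V : Type} (d : V → V → ℚ) (ht : ∀ u v w, d u v ≤ d u w + d w v)
    (a z b : V) (l₁ l₂ : List V) :
    walkC d a (l₁ ++ l₂) b ≤ walkC d a l₁ z + walkC d z l₂ b := by
  induction l₁ generalizing a with
  | nil => exact walkC_cons_le d ht _ _ _ _
  | cons y l ih => simp only [walkC, List.cons_append]; linarith [ih y]

theorem walkC_sublist {V : Type} (d : V → V → ℚ) (ht : ∀ u v w, d u v ≤ d u w + d w v)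
    (b : V) {l₁ l₂ : List V} (h : l₁.Sublist l₂) (a : V) :
    walkC d a l₁ b ≤ walkC d a l₂ b := by
  induction h generalizing a with
  | slnil => exact le_rfl
  | cons y _ ih =>
    simp only [walkC]
    exact (walkC_cons_le d ht a y b _).trans (by linarith [ih y])
  | cons_cons y _ ih => simp only [walkC]; linarith [ih y]

theorem walkC_reverse {V : Type} (d : V → V → ℚ) (a b : V) (l : List V) :
    walkC (fun i j => d j i) b l.reverse a = walkC d a l b := by
  induction l generalizing a with
  | nil => simp [walkC]
  | cons y l ih =>
    rw [List.reverse_cons, walkC_append, ih]; simp [walkC, add_comm]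

theorem walkC_flatMap {V W : Type} (d : V → V → ℚ) (ht : ∀ u v w, d u v ≤ d u w + d w v)
    (a : V) (ha : d a a = 0) (L : List W) (g : W → List V) (C : ℚ)
    (hC : ∀ r, walkC d a (g r) a ≤ C) :
    walkC d a (L.flatMap g) a ≤ L.length * C := by
  induction L with
  | nil => simp [walkC, ha]
  | cons r L ih =>
    rw [List.flatMap_cons]
    refine (walkC_append_le d ht a a a _ _).trans ?_
    push_cast [List.length_cons]
    linarith [hC r]

theorem walkC_add {V : Type} (d e : V → V → ℚ) (a b : V) (l : List V) :
    walkC (fun i j => d i j + e i j) a l b = walkC d a l b + walkC e a l b := by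
  induction l generalizing a with
  | nil => simp [walkC]
  | cons y l ih => simp only [walkC, ih]; ring

theorem walkC_ofFn {V : Type} (d : V → V → ℚ) (b : V) (n : ℕ) : ∀ (a : V) (g : Fin n → V),
    walkC d a (List.ofFn g) b =
      ∑ q : Fin (n + 1), d (Fin.cons (α := fun _ => V) a g q) (Fin.snoc (α := fun _ => V) g b q) := by
  induction n with
  | zero => intro a g; simp [walkC, Fin.snoc]
  | succ n ih =>
    intro a g
    rw [List.ofFn_succ, walkC, ih]
    refine Eq.trans ?_ (Fin.sum_univ_succ _).symm
    refine congrArg₂ (fun x y : ℚ => x + y) ?_ (Finset.sum_congr rfl fun q _ => ?_)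
    · have : Fin.snoc (α := fun _ => V) g b 0 = g 0 := by
        rw [← Fin.castSucc_zero, Fin.snoc_castSucc]
      simp [this]
    congr 1
    · simp only [Fin.cons_succ]
      refine Fin.cases ?_ (fun i => ?_) q <;> simp
    · refine Fin.lastCases ?_ (fun i => ?_) q
      · rw [Fin.succ_last]; simp
      · rw [Fin.succ_castSucc, Fin.snoc_castSucc, Fin.snoc_castSucc]

theorem tourValue_eq {n : ℕ} (d : Fin (n + 1) → Fin (n + 1) → ℚ) (σ : Equiv.Perm (Fin n)) :
    tourValue d σ = walkC d 0 ((List.ofFn σ).map Fin.succ) 0 := by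
  rw [List.map_ofFn, walkC_ofFn, tourValue]
  refine Finset.sum_congr rfl fun q _ => ?_
  congr 1
  · refine Fin.cases ?_ (fun i => ?_) q <;> simp [tourSeq, Fin.succ_ne_zero]
  · refine Fin.lastCases ?_ (fun i => ?_) q
    · simp [tourSeq]
    · simp [tourSeq, Fin.succ_ne_zero]

theorem exists_perm {n : ℕ} (L : List (Fin n)) (hL : L.Nodup) (hm : ∀ i, i ∈ L) :
    ∃ σ : Equiv.Perm (Fin n), List.ofFn σ = L := by
  have hlen : n = L.length := by
    have := ((List.perm_ext_iff_of_nodup hL (List.nodup_finRange n)).2 (by simp [hm])).length_eq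
    simpa using this.symm
  refine ⟨Equiv.ofBijective (fun i => L.get (i.cast hlen))
    (Finite.injective_iff_bijective.1 fun i j hij => ?_), ?_⟩
  · have := (List.nodup_iff_injective_get.1 hL) hij
    simpa using this
  · apply List.ext_getElem <;> simp [← hlen]

theorem rows_reverse {n k : ℕ} (f : Fin n → Fin k) (σP σD : Equiv.Perm (Fin n))
    (h : FeasibleFor f σP σD) (r : Fin k) :
    ((List.ofFn σP).filter (f · = r)).reverse = (List.ofFn σD).filter (f · = r) := by
  have pw : ∀ σ : Equiv.Perm (Fin n), (List.ofFn σ).Pairwise (visitsBefore σ) := by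
    intro σ
    rw [List.pairwise_ofFn]
    intro i j hij
    simpa [visitsBefore] using hij
  have nd : ∀ σ : Equiv.Perm (Fin n), (List.ofFn σ).Nodup :=
    fun σ => List.nodup_ofFn.2 σ.injective
  refine List.Perm.eq_of_pairwise (le := visitsBefore σD) ?_ ?_ ((pw σD).filter _) ?_
  · intro a b _ _ h1 h2
    exact absurd h1 (lt_asymm h2)
  · rw [List.pairwise_reverse]
    refine ((pw σP).filter (f · = r)).imp_of_mem ?_
    intro a b ha hb hab
    simp only [List.mem_filter, decide_eq_true_eq] at ha hb
    refine (h a b ?_ (ha.2.trans hb.2.symm)).1 hab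
    rintro rfl
    exact lt_irrefl _ hab
  · rw [List.perm_ext_iff_of_nodup (List.nodup_reverse.2 ((nd σP).filter _)) ((nd σD).filter _)]
    intro a
    have hs : ∀ σ : Equiv.Perm (Fin n), a ∈ List.ofFn σ := fun σ =>
      (List.mem_ofFn' _ _).2 (σ.surjective a)
    simp only [List.mem_reverse, List.mem_filter, hs]

/-- for every minimization instance of the DTSPMS in which `d_P` and `d_D`
are nonnegative and satisfy the triangle inequality, `OPT(I_Σ) ≤ k · OPT(I)`. -/
theorem stmt5 (n k c : ℕ) (hn : 1 ≤ n) (hk : 1 ≤ k) (hc : (n + k - 1) / k ≤ c)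
    (dP dD : Fin (n + 1) → Fin (n + 1) → ℚ)
    (hPnn : ∀ i j, 0 ≤ dP i j) (hDnn : ∀ i j, 0 ≤ dD i j)
    (hPdiag : ∀ i, dP i i = 0) (hDdiag : ∀ i, dD i i = 0)
    (hPtri : ∀ u v w, dP u v ≤ dP u w + dP w v)
    (hDtri : ∀ u v w, dD u v ≤ dD u w + dD w v)
    (optI optS : ℚ)
    (hoptI : IsLeast (feasibleValues n k c dP dD) optI)
    (hoptS : IsLeast (tourValues n (dSigma dP dD)) optS) :
    optS ≤ k * optI := by
  obtain ⟨⟨σP, σD, ⟨f, -, hf⟩, rfl⟩, -⟩ := hoptI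
  let g : Fin k → List (Fin n) := fun r => (List.ofFn σP).filter (f · = r)
  obtain ⟨σ, hσ⟩ := exists_perm ((List.finRange k).flatMap g) (by
      rw [List.nodup_flatMap]
      refine ⟨fun r _ => (List.nodup_ofFn.2 σP.injective).filter _, ?_⟩
      refine (List.nodup_finRange k).imp ?_
      intro r s hrs a ha hb
      simp only [g, List.mem_filter, decide_eq_true_eq] at ha hb
      exact hrs (ha.2.symm.trans hb.2)) (by
      intro i
      simp only [g, List.mem_flatMap, List.mem_filter, decide_eq_true_eq]
      exact ⟨f i, List.mem_finRange _, (List.mem_ofFn' _ _).2 (σP.surjective i), rfl⟩)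
  refine (hoptS.2 ⟨σ, rfl⟩).trans ?_
  have e : (dSigma dP dD) = fun i j => dP i j + (fun i j => dD j i) i j := rfl
  rw [tourValue_eq, hσ, e, walkC_add, List.map_flatMap, mul_add]
  refine add_le_add ?_ ?_
  · have := walkC_flatMap dP hPtri 0 (hPdiag 0) (List.finRange k) (fun r => (g r).map Fin.succ)
      (tourValue dP σP) (fun r => by
        rw [tourValue_eq]
        exact walkC_sublist dP hPtri 0 (List.filter_sublist.map _) 0)
    simpa using this
  · have := walkC_flatMap (fun i j => dD j i) (fun u v w => by
        simpa [add_comm] using hDtri v u w) 0 (hDdiag 0) (List.finRange k)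
      (fun r => (g r).map Fin.succ)
      (tourValue dD σD) (fun r => by
        rw [tourValue_eq, ← List.reverse_reverse ((g r).map Fin.succ), walkC_reverse,
          ← List.map_reverse, rows_reverse f σP σD hf r]
        exact walkC_sublist dD hDtri 0 (List.filter_sublist.map _) 0)
    simpa using this
end

section
/- Let 0 < a < b be rationals and let I be a minimization instance of the DTSPMS on V = {0,1,...,n} with parameters (k, c), c ≥ ⌈n/k⌉, in which d_P(i,j) ∈ {a, b} and d_D(i,j) ∈ {a, b} for all distinct i, j. Let ρ ≥ 1 and let T_P, T_D be tours with d_P(T_P) ≤ ρ·OPT(I_P) and d_D(T_D) ≤ ρ·OPT(I_D). Then min{ d_P(T_P) + d_D(T_P^-), d_P(T_D^-) + d_D(T_D) } ≤ ((ρ + b/a)/2)·OPT(I), where OPT(I) is the minimum value over feasible pairs and OPT(I_P), OPT(I_D) are the minimum tour values under d_P, d_D. -/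
open Finset

theorem tourSeq_ne {n : ℕ} (hn : 1 ≤ n) (σ : Equiv.Perm (Fin n)) (q : Fin (n + 1)) :
    tourSeq σ q ≠ tourSeq σ (q + 1) := by
  have hq : q ≠ q + 1 := by
    intro h
    have h1 : (1 : Fin (n + 1)) = 0 := by
      have h2 : q + 0 = q + 1 := by rw [add_zero]; exact h
      exact (add_left_cancel h2).symm
    have h3 := congrArg Fin.val h1
    rw [Fin.coe_ofNat_eq_mod, Fin.val_zero, Nat.mod_eq_of_lt (by omega)] at h3
    omega
  intro h
  unfold tourSeq at h
  split_ifs at h with h1 h2 h2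
  · exact hq (h1.trans h2.symm)
  · exact Fin.succ_ne_zero _ h.symm
  · exact Fin.succ_ne_zero _ h
  · have h3 := σ.injective (Fin.succ_injective _ h)
    exact hq (Fin.pred_inj.mp h3)

theorem tourValue_bounds {n : ℕ} (hn : 1 ≤ n) (a b : ℚ) (hab : a < b)
    (d : Fin (n + 1) → Fin (n + 1) → ℚ)
    (hval : ∀ i j, i ≠ j → d i j = a ∨ d i j = b) (σ : Equiv.Perm (Fin n)) :
    ((n : ℚ) + 1) * a ≤ tourValue d σ ∧ tourValue d σ ≤ ((n : ℚ) + 1) * b := by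
  unfold tourValue
  constructor
  · have := Finset.card_nsmul_le_sum Finset.univ
      (fun q : Fin (n + 1) => d (tourSeq σ q) (tourSeq σ (q + 1))) a (fun q _ => by
        rcases hval _ _ (tourSeq_ne hn σ q) with h | h <;> simp only [h] <;> linarith)
    simpa using this
  · have := Finset.sum_le_card_nsmul Finset.univ
      (fun q : Fin (n + 1) => d (tourSeq σ q) (tourSeq σ (q + 1))) b (fun q _ => by
        rcases hval _ _ (tourSeq_ne hn σ q) with h | h <;> simp only [h] <;> linarith)
    simpa using this

/-- minimization, bivalued distances in `{a, b}` with `0 < a < b`. If `T_P`,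
`T_D` are `ρ`-approximate tours for `d_P`, `d_D`, then the better of the pairs
`(T_P, T_P⁻)` and `(T_D⁻, T_D)` has value at most `((ρ + b/a)/2)·OPT(I)`. -/
theorem stmt9 (n k c : ℕ) (hn : 1 ≤ n) (hk : 1 ≤ k) (hc : (n + k - 1) / k ≤ c)
    (a b : ℚ) (ha : 0 < a) (hab : a < b)
    (dP dD : Fin (n + 1) → Fin (n + 1) → ℚ)
    (hPval : ∀ i j, i ≠ j → dP i j = a ∨ dP i j = b)
    (hDval : ∀ i j, i ≠ j → dD i j = a ∨ dD i j = b)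
    (hPdiag : ∀ i, dP i i = 0) (hDdiag : ∀ i, dD i i = 0)
    (ρ : ℚ) (hρ : 1 ≤ ρ)
    (optP optD optI : ℚ)
    (hoptP : IsLeast (tourValues n dP) optP)
    (hoptD : IsLeast (tourValues n dD) optD)
    (hoptI : IsLeast (feasibleValues n k c dP dD) optI)
    (TP TD : Equiv.Perm (Fin n))
    (hTP : tourValue dP TP ≤ ρ * optP)
    (hTD : tourValue dD TD ≤ ρ * optD) :
    min (tourValue dP TP + tourValue dD (revTour TP))
        (tourValue dP (revTour TD) + tourValue dD TD) ≤
      (ρ + b / a) / 2 * optI := by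
  obtain ⟨⟨σP, σD, -, hI⟩, -⟩ := hoptI
  have hP := hoptP.2 ⟨σP, rfl⟩
  have hD := hoptD.2 ⟨σD, rfl⟩
  have lP := (tourValue_bounds hn a b hab dP hPval σP).1
  have lD := (tourValue_bounds hn a b hab dD hDval σD).1
  have uP := (tourValue_bounds hn a b hab dP hPval (revTour TD)).2
  have uD := (tourValue_bounds hn a b hab dD hDval (revTour TP)).2
  have h1 : ρ * (optP + optD) ≤ ρ * optI :=
    mul_le_mul_of_nonneg_left (by linarith) (by linarith)
  have h2 : b / a * (2 * (((n : ℚ) + 1) * a)) ≤ b / a * optI :=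
    mul_le_mul_of_nonneg_left (by linarith) (div_nonneg (by linarith) ha.le)
  have h3 : b / a * (2 * (((n : ℚ) + 1) * a)) = 2 * (((n : ℚ) + 1) * b) := by
    field_simp
  by_contra! hcon
  obtain ⟨c1, c2⟩ := lt_min_iff.mp hcon
  have h4 : (ρ + b / a) / 2 * optI = (ρ * optI + b / a * optI) / 2 := by ring
  rw [h4] at c1 c2
  linarith
end

section
/- For every maximization instance I of the DTSPMS on V = {0,1,...,n} with parameters (k, c), c ≥ ⌈n/k⌉: 2·OPT(I_Σ) ≥ OPT(I) + WOR(I), where OPT(I) and WOR(I) are respectively the maximum and the minimum value d_P(T_P) + d_D(T_D) over feasible pairs (T_P, T_D), and OPT(I_Σ) is the maximum of d_Σ(T) over all tours T on V, with d_Σ(i,j) = d_P(i,j) + d_D(j,i). (For a minimization instance the inequality is reversed, with OPT the minimum over feasible pairs, WOR the maximum, and OPT(I_Σ) the minimum over tours.) -/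
open Finset

theorem tourSeq_rev {n : ℕ} (σ : Equiv.Perm (Fin n)) (q : Fin (n + 1)) :
    tourSeq (revTour σ) q = tourSeq σ (-q) := by
  refine Fin.cases ?_ (fun p => ?_) q
  · simp [tourSeq]
  · have h : -(p.succ) = (Fin.rev p).succ := by
      apply Fin.ext
      have := p.isLt
      rw [Fin.val_neg', Fin.val_succ, Fin.val_succ, Fin.val_rev, Nat.mod_eq_of_lt (by omega)]
      omega
    rw [h]
    simp [tourSeq, revTour]

theorem tourValue_rev {n : ℕ} (d : Fin (n + 1) → Fin (n + 1) → ℚ) (σ : Equiv.Perm (Fin n)) :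
    tourValue d (revTour σ) = tourValue (fun i j => d j i) σ := by
  unfold tourValue
  simp only [tourSeq_rev]
  refine Fintype.sum_equiv (Equiv.subLeft (-1)) _ _ (fun q => ?_)
  have h1 : (-1 - q : Fin (n + 1)) = -(q + 1) := by abel
  have h2 : (-1 - q + 1 : Fin (n + 1)) = -q := by abel
  simp only [Equiv.subLeft_apply]
  rw [h2, h1]

theorem visitsBefore_rev {n : ℕ} (σ : Equiv.Perm (Fin n)) (i j : Fin n) :
    visitsBefore (revTour σ) i j ↔ visitsBefore σ j i := by
  simp [visitsBefore, revTour]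

theorem tourValue_dSigma {n : ℕ} (dP dD : Fin (n + 1) → Fin (n + 1) → ℚ)
    (σ : Equiv.Perm (Fin n)) :
    tourValue (dSigma dP dD) σ = tourValue dP σ + tourValue dD (revTour σ) := by
  rw [tourValue_rev]
  simp [tourValue, dSigma, Finset.sum_add_distrib]

theorem revTour_revTour {n : ℕ} (σ : Equiv.Perm (Fin n)) : revTour (revTour σ) = σ := by
  ext x
  simp [revTour]

/-- for every maximization instance of the DTSPMS,
`2·OPT(I_Σ) ≥ OPT(I) + WOR(I)`. -/
theorem stmt16 (n k c : ℕ) (hn : 1 ≤ n) (hk : 1 ≤ k) (hc : (n + k - 1) / k ≤ c)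
    (dP dD : Fin (n + 1) → Fin (n + 1) → ℚ)
    (hPnn : ∀ i j, 0 ≤ dP i j) (hDnn : ∀ i j, 0 ≤ dD i j)
    (hPdiag : ∀ i, dP i i = 0) (hDdiag : ∀ i, dD i i = 0)
    (optI worI optS : ℚ)
    (hoptI : IsGreatest (feasibleValues n k c dP dD) optI)
    (hworI : IsLeast (feasibleValues n k c dP dD) worI)
    (hoptS : IsGreatest (tourValues n (dSigma dP dD)) optS) :
    optI + worI ≤ 2 * optS := by
  obtain ⟨⟨P, D, ⟨f, hf, hfe⟩, rfl⟩, -⟩ := hoptI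
  have h1 := hworI.2 ⟨revTour D, revTour P, ⟨f, hf, fun i j hij hfij => by
    rw [visitsBefore_rev, visitsBefore_rev]
    exact (hfe i j hij hfij).symm⟩, rfl⟩
  have h2 := hoptS.2 ⟨P, rfl⟩
  have h3 := hoptS.2 ⟨revTour D, rfl⟩
  rw [tourValue_dSigma] at h2 h3
  rw [revTour_revTour] at h3
  linarith
end
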